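/- arXiv:2306.07862 — 3 statements merged into one kernel-verified Lean document; each statement's English description precedes it below -/
import Mathlib

section
/- Let G = (V,E) be a connected simple graph on at least two vertices. A code C ⊆ V is solid-locating-dominating in G if and only if for all u ∈ V \ C we have I(C;u) ≠ ∅ and ( ⋂_{c ∈ I(C;u)} N[c] ) \ C = {u}. -/
open Set

/-- The closed neighbourhood N[v] of a vertex in a simple graph. -/
def closedNbhd {V : Type*} (G : SimpleGraph V) (v : V) : Set V :=
  insert v (G.neighborSet v)

/-- The identifying set I(C;v) = N[v] ∩ C. -/
def iSet {V : Type*} (G : SimpleGraph V) (C : Set V) (v : V) : Set V :=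
  closedNbhd G v ∩ C

/-- C is a locating-dominating code: for all distinct non-codewords u, v,
    I(C;u) ≠ ∅ and I(C;u) ≠ I(C;v). -/
def IsLocDom {V : Type*} (G : SimpleGraph V) (C : Set V) : Prop :=
  ∀ u ∉ C, ∀ v ∉ C, u ≠ v → (iSet G C u).Nonempty ∧ iSet G C u ≠ iSet G C v

/-- C is a solid-locating-dominating code: for all distinct non-codewords u, v,
    I(C;u) \ I(C;v) ≠ ∅. -/
def IsSolidLocDom {V : Type*} (G : SimpleGraph V) (C : Set V) : Prop :=
  ∀ u ∉ C, ∀ v ∉ C, u ≠ v → (iSet G C u \ iSet G C v).Nonempty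

/-- C is a self-locating-dominating code: for all non-codewords u,
    I(C;u) ≠ ∅ and ⋂_{c ∈ I(C;u)} N[c] = {u}. -/
def IsSelfLocDom {V : Type*} (G : SimpleGraph V) (C : Set V) : Prop :=
  ∀ u ∉ C, (iSet G C u).Nonempty ∧ (⋂ c ∈ iSet G C u, closedNbhd G c) = {u}

theorem mem_closedNbhd_comm {V : Type*} (G : SimpleGraph V) {u v : V} :
    u ∈ closedNbhd G v ↔ v ∈ closedNbhd G u := by
  simp [closedNbhd, G.adj_comm u v, eq_comm]

/-- A vertex lies in ⋂_{c ∈ I(C;u)} N[c] iff its identifying set contains I(C;u). -/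
theorem mem_iInter_closedNbhd_iff {V : Type*} (G : SimpleGraph V) {C : Set V} {u v : V} :
    v ∈ ⋂ c ∈ iSet G C u, closedNbhd G c ↔ iSet G C u ⊆ iSet G C v := by
  rw [mem_iInter₂]
  exact ⟨fun h c hc => ⟨(mem_closedNbhd_comm G).1 (h c hc), hc.2⟩,
    fun h c hc => (mem_closedNbhd_comm G).1 (h hc).1⟩

theorem IsSolidLocDom.iSet_nonempty {V : Type*} {G : SimpleGraph V} (hG : G.Connected)
    [Nontrivial V] {C : Set V} (h : IsSolidLocDom G C) {u : V} (hu : u ∉ C) :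
    (iSet G C u).Nonempty := by
  obtain ⟨w, hw⟩ := hG.preconnected.exists_adj_of_nontrivial u
  by_cases hwC : w ∈ C
  · exact ⟨w, mem_insert_of_mem _ hw, hwC⟩
  · exact (h u hu w hwC hw.ne).mono sdiff_subset

/-- Characterization of solid-locating-dominating codes:
    C is solid-locating-dominating iff for all u ∈ V \ C, I(C;u) ≠ ∅ and
    ( ⋂_{c ∈ I(C;u)} N[c] ) \ C = {u}. -/
theorem solidLocDom_characterization {V : Type*} (G : SimpleGraph V)
    (hG : G.Connected) (hV : Nontrivial V) (C : Set V) (hC : C.Nonempty) :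
    IsSolidLocDom G C ↔
      ∀ u ∉ C, (iSet G C u).Nonempty ∧
        ((⋂ c ∈ iSet G C u, closedNbhd G c) \ C) = {u} := by
  constructor
  · refine fun h u hu => ⟨h.iSet_nonempty hG hu, Set.ext fun v => ?_⟩
    rw [mem_sdiff, mem_iInter_closedNbhd_iff, mem_singleton_iff]
    constructor
    · rintro ⟨huv, hv⟩
      by_contra hne
      exact sdiff_nonempty.1 (h u hu v hv (Ne.symm hne)) huv
    · rintro rfl
      exact ⟨Subset.rfl, hu⟩
  · intro h u hu v hv hne
    rw [sdiff_nonempty]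
    intro huv
    have hmem : v ∈ (⋂ c ∈ iSet G C u, closedNbhd G c) \ C :=
      ⟨(mem_iInter_closedNbhd_iff G).2 huv, hv⟩
    rw [(h u hu).2] at hmem
    exact hne hmem.symm
end

section
/- Let C be a solid-locating-dominating code in the infinite king grid. Then for all i, j ∈ ℤ, the set T = {(i,j), (i,j+1), (i,j+2), (i+1,j+2), (i−1,j+2)} contains a codeword of C, and the same holds for any set obtained from T by a rotation of π/2, π or 3π/2 radians around the origin. -/
open Set

/-- The infinite king grid: vertex set ℤ², distinct vertices (v₁,v₂), (u₁,u₂)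
    adjacent iff |v₁−u₁| ≤ 1 and |v₂−u₂| ≤ 1. -/
def kingGrid : SimpleGraph (ℤ × ℤ) :=
  SimpleGraph.fromRel (fun u v => |u.1 - v.1| ≤ 1 ∧ |u.2 - v.2| ≤ 1)

/-- Rotation of the plane ℤ² by π/2 radians around the origin. -/
def rotQuarter (p : ℤ × ℤ) : ℤ × ℤ := (-p.2, p.1)

/-- The T-shaped pattern {(i,j), (i,j+1), (i,j+2), (i+1,j+2), (i−1,j+2)}. -/
def tPattern (i j : ℤ) : Set (ℤ × ℤ) :=
  {(i, j), (i, j + 1), (i, j + 2), (i + 1, j + 2), (i - 1, j + 2)}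

theorem mem_closedNbhd_kingGrid {u p : ℤ × ℤ} :
    p ∈ closedNbhd kingGrid u ↔ |u.1 - p.1| ≤ 1 ∧ |u.2 - p.2| ≤ 1 := by
  simp only [closedNbhd, kingGrid, mem_insert_iff, SimpleGraph.mem_neighborSet,
    SimpleGraph.fromRel_adj, abs_sub_comm p.1, abs_sub_comm p.2, or_self]
  by_cases h : p = u
  · simp [h]
  · simp [h, Ne.symm h]

/-- A set containing two distinct vertices `u`, `v` and all of `N[u] \ N[v]` meets every
solid-locating-dominating code. -/
theorem IsSolidLocDom.inter_nonempty_of_sdiff_subset {C S : Set (ℤ × ℤ)}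
    (hC : IsSolidLocDom kingGrid C) (u v : ℤ × ℤ) (huv : u ≠ v) (hu : u ∈ S) (hv : v ∈ S)
    (hS : ∀ p : ℤ × ℤ, |u.1 - p.1| ≤ 1 ∧ |u.2 - p.2| ≤ 1 →
      ¬(|v.1 - p.1| ≤ 1 ∧ |v.2 - p.2| ≤ 1) → p ∈ S) :
    (S ∩ C).Nonempty := by
  by_cases huC : u ∈ C
  · exact ⟨u, hu, huC⟩
  by_cases hvC : v ∈ C
  · exact ⟨v, hv, hvC⟩
  obtain ⟨p, ⟨hpu, hpC⟩, hpv⟩ := hC u huC v hvC huv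
  exact ⟨p, hS p (mem_closedNbhd_kingGrid.1 hpu)
    fun h => hpv ⟨mem_closedNbhd_kingGrid.2 h, hpC⟩, hpC⟩

theorem tPattern_image {α : Type*} (f : ℤ × ℤ → α) (i j : ℤ) :
    f '' tPattern i j =
      {f (i, j), f (i, j + 1), f (i, j + 2), f (i + 1, j + 2), f (i - 1, j + 2)} := by
  simp only [tPattern, image_insert_eq, image_singleton]

/-- If C is solid-locating-dominating in the king grid, then every pattern T,
    and every rotation of T by π/2, π or 3π/2 around the origin, contains a
    codeword of C. -/
theorem kingGrid_no_empty_tPattern (C : Set (ℤ × ℤ)) (hCne : C.Nonempty)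
    (hC : IsSolidLocDom kingGrid C) (i j : ℤ) :
    (tPattern i j ∩ C).Nonempty ∧
    (rotQuarter '' tPattern i j ∩ C).Nonempty ∧
    ((rotQuarter ∘ rotQuarter) '' tPattern i j ∩ C).Nonempty ∧
    ((rotQuarter ∘ rotQuarter ∘ rotQuarter) '' tPattern i j ∩ C).Nonempty := by
  refine ⟨?_, ?_, ?_, ?_⟩
  · exact hC.inter_nonempty_of_sdiff_subset (i, j + 1) (i, j) (by grind)
      (by grind [tPattern]) (by grind [tPattern])
      (by
        rintro ⟨x, y⟩
        simp only [tPattern, mem_insert_iff, mem_singleton_iff, Prod.mk.injEq, abs_le]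
        omega)
  · rw [tPattern_image]
    exact hC.inter_nonempty_of_sdiff_subset (rotQuarter (i, j + 1)) (rotQuarter (i, j))
      (by grind [rotQuarter]) (by grind) (by grind)
      (by
        rintro ⟨x, y⟩
        simp only [rotQuarter, mem_insert_iff, mem_singleton_iff, Prod.mk.injEq, abs_le]
        omega)
  · rw [tPattern_image]
    exact hC.inter_nonempty_of_sdiff_subset ((rotQuarter ∘ rotQuarter) (i, j + 1))
      ((rotQuarter ∘ rotQuarter) (i, j))
      (by grind [rotQuarter]) (by grind) (by grind)
      (by
        rintro ⟨x, y⟩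
        simp only [rotQuarter, Function.comp_apply, mem_insert_iff, mem_singleton_iff,
          Prod.mk.injEq, abs_le]
        omega)
  · rw [tPattern_image]
    exact hC.inter_nonempty_of_sdiff_subset ((rotQuarter ∘ rotQuarter ∘ rotQuarter) (i, j + 1))
      ((rotQuarter ∘ rotQuarter ∘ rotQuarter) (i, j))
      (by grind [rotQuarter]) (by grind) (by grind)
      (by
        rintro ⟨x, y⟩
        simp only [rotQuarter, Function.comp_apply, mem_insert_iff, mem_singleton_iff,
          Prod.mk.injEq, abs_le]
        omega)
end

section
/- In the infinite king grid G, the code C = { (x,y) ∈ ℤ² : x − y ≡ 0 (mod 3) } is a self-locating-dominating code, and its density D(C) equals 1/3. -/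
open Set

/-- The square V_n = { (x,y) : |x| ≤ n, |y| ≤ n } of index pairs. -/
def gridBox (n : ℕ) : Set (ℤ × ℤ) := {p | |p.1| ≤ (n : ℤ) ∧ |p.2| ≤ (n : ℤ)}

/-- The density D(C) = limsup_{n→∞} |C ∩ V_n| / |V_n| of a code in an infinite grid
    whose vertices are indexed by ℤ². -/
noncomputable def gridDensity (C : Set (ℤ × ℤ)) : ℝ :=
  Filter.limsup
    (fun n : ℕ => ((C ∩ gridBox n).ncard : ℝ) / ((gridBox n).ncard : ℝ))
    Filter.atTop

theorem mem_closedNbhd_kingGrid_s10 {v w : ℤ × ℤ} :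
    w ∈ closedNbhd kingGrid v ↔ |v.1 - w.1| ≤ 1 ∧ |v.2 - w.2| ≤ 1 := by
  simp only [closedNbhd, kingGrid, Set.mem_insert_iff, SimpleGraph.mem_neighborSet,
    SimpleGraph.fromRel_adj, abs_sub_comm w.1, abs_sub_comm w.2, or_self]
  constructor
  · rintro (rfl | h)
    · simp
    · exact h.2
  · intro h
    by_cases hvw : w = v
    · exact Or.inl hvw
    · exact Or.inr ⟨Ne.symm hvw, h⟩

theorem isSelfLocDom_kingGrid_diagonals :
    IsSelfLocDom kingGrid {p : ℤ × ℤ | (p.1 - p.2) % 3 = 0} := by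
  rintro ⟨x, y⟩ hu
  simp only [Set.mem_ofPred_eq] at hu
  have mem_iSet : ∀ a b : ℤ, |a| ≤ 1 → |b| ≤ 1 → (x - y + (a - b)) % 3 = 0 →
      (x + a, y + b) ∈ iSet kingGrid {p : ℤ × ℤ | (p.1 - p.2) % 3 = 0} (x, y) := by
    intro a b ha hb h
    refine ⟨mem_closedNbhd_kingGrid_s10.2 (by simpa using And.intro ha hb), ?_⟩
    change (x + a - (y + b)) % 3 = 0
    rwa [add_sub_add_comm]
  -- the three codewords around a non-codeword are `u + e • (1, 0)`, `u - e • (0, 1)`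
  -- and `u + e • (-1, 1)`, for a sign `e`
  obtain ⟨e, he, hmod⟩ : ∃ e : ℤ, (e = 1 ∨ e = -1) ∧ (x - y + e) % 3 = 0 := by
    rcases (by omega : (x - y) % 3 = 1 ∨ (x - y) % 3 = 2) with h | h
    · exact ⟨-1, by omega, by omega⟩
    · exact ⟨1, by omega, by omega⟩
  have habs : |e| ≤ 1 := by rcases he with rfl | rfl <;> simp
  have h₁ := mem_iSet e 0 habs (by simp) (by omega)
  have h₂ := mem_iSet 0 (-e) (by simp) (by simpa using habs) (by omega)
  have h₃ := mem_iSet (-e) e (by simpa using habs) habs (by omega)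
  refine ⟨⟨_, h₁⟩, Set.Subset.antisymm ?_ ?_⟩
  · rintro ⟨a, b⟩ hab
    rw [Set.mem_iInter₂] at hab
    have k₁ := mem_closedNbhd_kingGrid_s10.1 (hab _ h₁)
    have k₂ := mem_closedNbhd_kingGrid_s10.1 (hab _ h₂)
    have k₃ := mem_closedNbhd_kingGrid_s10.1 (hab _ h₃)
    simp only [abs_le] at k₁ k₂ k₃
    simp only [Set.mem_singleton_iff, Prod.mk.injEq]
    omega
  · rintro _ rfl
    rw [Set.mem_iInter₂]
    intro c hc
    have := mem_closedNbhd_kingGrid_s10.1 hc.1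
    rw [mem_closedNbhd_kingGrid_s10, abs_sub_comm, abs_sub_comm c.2]
    exact this

theorem gridBox_eq_coe (n : ℕ) :
    gridBox n = ((Finset.Icc (-n : ℤ) n ×ˢ Finset.Icc (-n : ℤ) n : Finset (ℤ × ℤ)) :
      Set (ℤ × ℤ)) := by
  ext p
  simp only [gridBox, Set.mem_ofPred_eq, Finset.coe_product, Finset.coe_Icc, Set.mem_prod,
    Set.mem_Icc, abs_le]

theorem ncard_gridBox (n : ℕ) : (gridBox n).ncard = (2 * n + 1) ^ 2 := by
  rw [gridBox_eq_coe, Set.ncard_coe_finset, Finset.card_product, Int.card_Icc, sq]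
  congr 1 <;> omega

theorem abs_three_mul_card_filter_modEq_three_sub_le (n : ℕ) (c : ℤ) :
    |3 * (((Finset.Icc (-n : ℤ) n).filter (fun y => (c - y) % 3 = 0)).card : ℤ) - (2 * n + 1)|
      ≤ 2 := by
  have hset : (Finset.Icc (-n : ℤ) n).filter (fun y => (c - y) % 3 = 0) =
      (Finset.Ioc (-n - 1 : ℤ) n).filter (fun y => y ≡ c [ZMOD 3]) := by
    ext y
    simp only [Finset.mem_filter, Finset.mem_Icc, Finset.mem_Ioc]
    unfold Int.ModEq
    omega
  have floor_eq : ∀ a : ℤ, ⌊((a : ℚ) - c) / ((3 : ℤ) : ℚ)⌋ = (a - c) / 3 := by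
    intro a
    rw [← Int.cast_sub]
    exact Rat.floor_intCast_div_natCast (a - c) 3
  rw [hset, Int.Ioc_filter_modEq_card _ _ (by norm_num), floor_eq, floor_eq, abs_le]
  omega

theorem abs_three_mul_ncard_diagonals_sub_le (n : ℕ) :
    |3 * (({p : ℤ × ℤ | (p.1 - p.2) % 3 = 0} ∩ gridBox n).ncard : ℤ) - (2 * n + 1 : ℤ) ^ 2|
      ≤ (2 * (2 * n + 1) : ℤ) := by
  have hcard : (({p : ℤ × ℤ | (p.1 - p.2) % 3 = 0} ∩ gridBox n).ncard : ℤ) =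
      ∑ x ∈ Finset.Icc (-n : ℤ) n,
        (((Finset.Icc (-n : ℤ) n).filter (fun y => (x - y) % 3 = 0)).card : ℤ) := by
    have hset : {p : ℤ × ℤ | (p.1 - p.2) % 3 = 0} ∩ gridBox n =
        (((Finset.Icc (-n : ℤ) n ×ˢ Finset.Icc (-n : ℤ) n).filter
          (fun p => (p.1 - p.2) % 3 = 0) : Finset (ℤ × ℤ)) : Set (ℤ × ℤ)) := by
      rw [gridBox_eq_coe, Finset.coe_filter, Set.inter_comm]
      rfl
    rw [hset, Set.ncard_coe_finset, Finset.card_filter, Finset.sum_product]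
    simp only [Finset.card_filter, Nat.cast_sum]
  have hside : ((Finset.Icc (-n : ℤ) n).card : ℤ) = 2 * n + 1 := by
    rw [Int.card_Icc]
    omega
  have hsq : ((2 * n + 1) ^ 2 : ℤ) = ∑ _x ∈ Finset.Icc (-n : ℤ) n, (2 * n + 1 : ℤ) := by
    rw [Finset.sum_const, nsmul_eq_mul, hside, sq]
  rw [hcard, hsq, Finset.mul_sum, ← Finset.sum_sub_distrib]
  refine (Finset.abs_sum_le_sum_abs _ _).trans ?_
  refine (Finset.sum_le_card_nsmul _ _ 2
    fun x _ => abs_three_mul_card_filter_modEq_three_sub_le n x).trans_eq ?_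
  rw [nsmul_eq_mul, hside, mul_comm]

theorem gridDensity_diagonals :
    gridDensity {p : ℤ × ℤ | (p.1 - p.2) % 3 = 0} = 1 / 3 := by
  refine Filter.Tendsto.limsup_eq ?_
  rw [tendsto_iff_norm_sub_tendsto_zero]
  refine squeeze_zero (fun _ => norm_nonneg _) (fun n => ?_)
    (tendsto_one_div_add_atTop_nhds_zero_nat (𝕜 := ℝ))
  have hbound : |3 * (({p : ℤ × ℤ | (p.1 - p.2) % 3 = 0} ∩ gridBox n).ncard : ℝ) -
      (2 * n + 1 : ℝ) ^ 2| ≤ (2 * (2 * n + 1) : ℝ) := by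
    have := Int.cast_le (R := ℝ) |>.2 (abs_three_mul_ncard_diagonals_sub_le n)
    push_cast at this
    exact this
  rw [ncard_gridBox, Real.norm_eq_abs]
  push_cast
  generalize (({p : ℤ × ℤ | (p.1 - p.2) % 3 = 0} ∩ gridBox n).ncard : ℝ) = N at hbound ⊢
  have hn : (0 : ℝ) ≤ n := n.cast_nonneg
  have hrw : N / (2 * (n : ℝ) + 1) ^ 2 - 1 / 3 =
      (3 * N - (2 * n + 1) ^ 2) / (3 * (2 * n + 1) ^ 2) := by
    field_simp
  rw [hrw, abs_div, abs_of_pos (by positivity : (0 : ℝ) < 3 * (2 * n + 1) ^ 2),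
    div_le_div_iff₀ (by positivity) (by positivity)]
  nlinarith [mul_le_mul_of_nonneg_right hbound (by positivity : (0 : ℝ) ≤ n + 1)]

/-- In the king grid, { (x,y) : x − y ≡ 0 (mod 3) } is a
    self-locating-dominating code of density 1/3. -/
theorem kingGrid_selfLocDom_density :
    IsSelfLocDom kingGrid {p : ℤ × ℤ | (p.1 - p.2) % 3 = 0} ∧
    gridDensity {p : ℤ × ℤ | (p.1 - p.2) % 3 = 0} = 1 / 3 :=
  ⟨isSelfLocDom_kingGrid_diagonals, gridDensity_diagonals⟩
end
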